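/- Reflection formula: γ(z)·γ(1+τ−z) = −τ·γ(1)²·exp(iπ z(1+τ−z)/τ) for all z where both sides are defined. -/

import Mathlib

open Complex

/-- Numerator `(q² e^{-2iπz}; q²)_∞ = ∏_{n≥1} (1 - e^{-2iπ(z - nτ)})` with `q = e^{iπτ}`. -/
noncomputable def gammaNum (τ z : ℂ) : ℂ :=
  ∏' n : ℕ, (1 - Complex.exp (-(2 * Real.pi * Complex.I) * (z - ((n : ℂ) + 1) * τ)))

/-- Denominator `(e^{-2iπz/τ}; q^{-2/τ²})_∞ = ∏_{n≥0} (1 - e^{-2iπ(z+n)/τ})`. -/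
noncomputable def gammaDen (τ z : ℂ) : ℂ :=
  ∏' n : ℕ, (1 - Complex.exp (-(2 * Real.pi * Complex.I) * (z + (n : ℂ)) / τ))

/-- The γ-function as a ratio of two infinite products. -/
noncomputable def gammaFn (τ z : ℂ) : ℂ := gammaNum τ z / gammaDen τ z

open Filter Topology

/-- The infinite `q`-Pochhammer symbol `(u; a)_∞ = ∏_{n≥0} (1 - u aⁿ)`. -/
noncomputable def qPochhammer (a u : ℂ) : ℂ := ∏' n : ℕ, (1 - u * a ^ n)

lemma summable_norm_neg_mul_pow {a : ℂ} (ha : ‖a‖ < 1) (u : ℂ) :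
    Summable fun n : ℕ ↦ ‖-(u * a ^ n)‖ := by
  simpa using (summable_geometric_of_lt_one (norm_nonneg a) ha).mul_left ‖u‖

lemma qPochhammer_eq_one_sub_mul {a : ℂ} (ha : ‖a‖ < 1) (u : ℂ) :
    qPochhammer a u = (1 - u) * qPochhammer a (u * a) := by
  have hm : Multipliable fun n : ℕ ↦ 1 - u * a ^ (n + 1) := by
    have := multipliable_one_add_of_summable (summable_norm_neg_mul_pow ha (u * a))
    simpa only [pow_succ', ← mul_assoc, sub_eq_add_neg] using this
  unfold qPochhammer
  rw [tprod_eq_zero_mul' (f := fun n : ℕ ↦ 1 - u * a ^ n) hm, pow_zero, mul_one]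
  simp only [pow_succ', ← mul_assoc]

lemma qPochhammer_one_right {a : ℂ} (ha : ‖a‖ < 1) : qPochhammer a 1 = 0 := by
  rw [qPochhammer_eq_one_sub_mul ha]
  simp

lemma qPochhammer_ne_zero {a u : ℂ} (ha : ‖a‖ < 1) (h : ∀ n : ℕ, u * a ^ n ≠ 1) :
    qPochhammer a u ≠ 0 := by
  have := tprod_one_add_ne_zero_of_summable (f := fun n : ℕ ↦ -(u * a ^ n))
    (fun n hn ↦ h n (by linear_combination -hn)) (summable_norm_neg_mul_pow ha u)
  simpa [qPochhammer, sub_eq_add_neg] using this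

lemma qPochhammer_self_ne_zero {a : ℂ} (ha : ‖a‖ < 1) : qPochhammer a a ≠ 0 := by
  refine qPochhammer_ne_zero ha fun n hn ↦ ?_
  have h : ‖a‖ ^ (n + 1) < 1 := pow_lt_one₀ (norm_nonneg a) ha n.succ_ne_zero
  rw [← norm_pow, pow_succ', hn] at h
  simp at h

lemma differentiable_qPochhammer {a : ℂ} (ha : ‖a‖ < 1) :
    Differentiable ℂ (qPochhammer a) := by
  intro u
  have hsum : Summable fun n : ℕ ↦ (‖u‖ + 1) * ‖a‖ ^ n :=
    (summable_geometric_of_lt_one (norm_nonneg a) ha).mul_left _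
  have hprod := hsum.hasProdLocallyUniformlyOn_nat_one_add
    (f := fun (n : ℕ) (v : ℂ) ↦ -(v * a ^ n)) (K := Metric.ball 0 (‖u‖ + 1)) Metric.isOpen_ball
    (.of_forall fun n v hv ↦ by
      rw [norm_neg, norm_mul, norm_pow]
      have : ‖v‖ < ‖u‖ + 1 := by simpa using hv
      gcongr) (fun n ↦ by fun_prop)
  have hdiff := hprod.differentiableOn
    (.of_forall fun s ↦ by
      simpa [Finset.prod_fn] using DifferentiableOn.finsetProd (fun _ _ ↦ by fun_prop))
    Metric.isOpen_ball
  have hu : DifferentiableAt ℂ (fun v ↦ ∏' n : ℕ, (1 + -(v * a ^ n))) u :=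
    hdiff.differentiableAt (Metric.isOpen_ball.mem_nhds (by simp))
  simp only [← sub_eq_add_neg] at hu
  exact hu

/-- The character `z ↦ e^{2πiz}`. -/
noncomputable def expTwoPiI (z : ℂ) : ℂ := exp (2 * Real.pi * I * z)

lemma expTwoPiI_add (z w : ℂ) : expTwoPiI (z + w) = expTwoPiI z * expTwoPiI w := by
  simp [expTwoPiI, mul_add, exp_add]

lemma expTwoPiI_neg (z : ℂ) : expTwoPiI (-z) = (expTwoPiI z)⁻¹ := by
  simp [expTwoPiI, exp_neg]

lemma expTwoPiI_sub (z w : ℂ) : expTwoPiI (z - w) = expTwoPiI z / expTwoPiI w := by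
  simp [expTwoPiI, mul_sub, exp_sub]

lemma expTwoPiI_ne_zero (z : ℂ) : expTwoPiI z ≠ 0 := exp_ne_zero _

lemma expTwoPiI_zero : expTwoPiI 0 = 1 := by simp [expTwoPiI]

lemma expTwoPiI_one : expTwoPiI 1 = 1 := by simp [expTwoPiI, exp_two_pi_mul_I]

lemma expTwoPiI_nat_mul (n : ℕ) (z : ℂ) : expTwoPiI (n * z) = expTwoPiI z ^ n := by
  rw [expTwoPiI, expTwoPiI, ← exp_nat_mul]
  ring_nf

lemma expTwoPiI_eq_one_iff {z : ℂ} : expTwoPiI z = 1 ↔ ∃ n : ℤ, z = n := by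
  rw [expTwoPiI, exp_eq_one_iff]
  refine exists_congr fun n ↦ ?_
  rw [mul_comm (n : ℂ)]
  exact mul_right_inj' two_pi_I_ne_zero

lemma norm_expTwoPiI_lt_one {σ : ℂ} (hσ : 0 < σ.im) : ‖expTwoPiI σ‖ < 1 := by
  simpa [expTwoPiI] using UpperHalfPlane.norm_exp_two_pi_I_lt_one ⟨σ, hσ⟩

lemma hasDerivAt_expTwoPiI (z : ℂ) :
    HasDerivAt expTwoPiI (2 * Real.pi * I * expTwoPiI z) z := by
  have := ((hasDerivAt_id z).const_mul (2 * Real.pi * I : ℂ)).cexp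
  rw [mul_one, mul_comm (exp _)] at this
  exact this

lemma differentiable_expTwoPiI : Differentiable ℂ expTwoPiI :=
  fun z ↦ (hasDerivAt_expTwoPiI z).differentiableAt

/-- The theta product `(x; q)_∞ (q/x; q)_∞` with `x = e^{2πiz}` and `q = e^{2πiσ}`. -/
noncomputable def thetaProd (σ z : ℂ) : ℂ :=
  qPochhammer (expTwoPiI σ) (expTwoPiI z) * qPochhammer (expTwoPiI σ) (expTwoPiI (σ - z))

section thetaProd

variable {σ : ℂ}

lemma thetaProd_add_one (z : ℂ) : thetaProd σ (z + 1) = thetaProd σ z := by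
  simp [thetaProd, expTwoPiI_add, expTwoPiI_sub, expTwoPiI_one]

lemma thetaProd_sub_one (z : ℂ) : thetaProd σ (z - 1) = thetaProd σ z := by
  rw [← thetaProd_add_one, sub_add_cancel]

lemma thetaProd_add_period (hσ : 0 < σ.im) (z : ℂ) :
    thetaProd σ (z + σ) = -expTwoPiI (-z) * thetaProd σ z := by
  have ha := norm_expTwoPiI_lt_one hσ
  have h₁ := qPochhammer_eq_one_sub_mul ha (expTwoPiI z)
  have h₂ := qPochhammer_eq_one_sub_mul ha (expTwoPiI (-z))
  have hz : expTwoPiI (-z) * expTwoPiI z = 1 := by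
    rw [← expTwoPiI_add, neg_add_cancel, expTwoPiI_zero]
  simp only [← expTwoPiI_add] at h₁ h₂
  rw [neg_add_eq_sub] at h₂
  rw [thetaProd, thetaProd, show σ - (z + σ) = -z by ring, h₁, h₂]
  linear_combination -(qPochhammer (expTwoPiI σ) (expTwoPiI (z + σ)) *
    qPochhammer (expTwoPiI σ) (expTwoPiI (σ - z))) * hz

lemma thetaProd_sub_period (hσ : 0 < σ.im) (z : ℂ) :
    thetaProd σ (z - σ) = -expTwoPiI (z - σ) * thetaProd σ z := by
  have h := thetaProd_add_period hσ (z - σ)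
  rw [sub_add_cancel, expTwoPiI_neg] at h
  rw [h]
  field_simp [expTwoPiI_ne_zero (z - σ)]

lemma exists_int_of_thetaProd_eq_zero (hσ : 0 < σ.im) {z : ℂ} (hz : thetaProd σ z = 0) :
    ∃ m n : ℤ, z = m + n * σ := by
  have ha := norm_expTwoPiI_lt_one hσ
  by_contra! h
  refine mul_ne_zero (qPochhammer_ne_zero ha fun n hn ↦ ?_)
    (qPochhammer_ne_zero ha fun n hn ↦ ?_) hz
  · rw [← expTwoPiI_nat_mul, ← expTwoPiI_add, expTwoPiI_eq_one_iff] at hn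
    obtain ⟨m, hm⟩ := hn
    exact h m (-n) (by push_cast; linear_combination hm)
  · rw [← expTwoPiI_nat_mul, ← expTwoPiI_add, expTwoPiI_eq_one_iff] at hn
    obtain ⟨m, hm⟩ := hn
    exact h (-m) (n + 1) (by push_cast; linear_combination -hm)

lemma differentiable_thetaProd (hσ : 0 < σ.im) : Differentiable ℂ (thetaProd σ) := by
  have hP := differentiable_qPochhammer (norm_expTwoPiI_lt_one hσ)
  exact (hP.comp differentiable_expTwoPiI).mul
    (hP.comp (differentiable_expTwoPiI.comp (differentiable_id.const_sub σ)))

lemma thetaProd_zero (hσ : 0 < σ.im) : thetaProd σ 0 = 0 := by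
  simp [thetaProd, expTwoPiI_zero, qPochhammer_one_right (norm_expTwoPiI_lt_one hσ)]

lemma hasDerivAt_thetaProd_zero (hσ : 0 < σ.im) :
    HasDerivAt (thetaProd σ)
      (-(2 * Real.pi * I) * qPochhammer (expTwoPiI σ) (expTwoPiI σ) ^ 2) 0 := by
  have ha := norm_expTwoPiI_lt_one hσ
  have hP := differentiable_qPochhammer ha
  set r : ℂ → ℂ := fun z ↦ qPochhammer (expTwoPiI σ) (expTwoPiI (z + σ)) *
    qPochhammer (expTwoPiI σ) (expTwoPiI (σ - z)) with hr
  have hrd : Differentiable ℂ r :=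
    (hP.comp (differentiable_expTwoPiI.comp (differentiable_id.add_const σ))).mul
      (hP.comp (differentiable_expTwoPiI.comp (differentiable_id.const_sub σ)))
  have heq : thetaProd σ = fun z ↦ (1 - expTwoPiI z) * r z := by
    ext z
    rw [thetaProd, qPochhammer_eq_one_sub_mul ha (expTwoPiI z), ← expTwoPiI_add, mul_assoc]
  rw [heq]
  convert! ((hasDerivAt_expTwoPiI 0).const_sub 1).mul (hrd 0).hasDerivAt using 1
  simp [hr, expTwoPiI_zero]
  ring

end thetaProd

/-- A continuous function with periods `1` and `τ` is bounded. -/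
lemma isBounded_range_of_doubly_periodic {τ : ℂ} (hτ : 0 < τ.im) {F : ℂ → ℂ}
    (hF : Continuous F) (h₁ : Function.Periodic F 1) (h₂ : Function.Periodic F τ) :
    Bornology.IsBounded (Set.range F) := by
  have hK : IsCompact ((fun p : ℝ × ℝ ↦ F (p.1 + p.2 * τ)) '' (Set.Icc 0 1 ×ˢ Set.Icc 0 1)) :=
    (isCompact_Icc.prod isCompact_Icc).image (by fun_prop)
  refine hK.isBounded.subset ?_
  rintro _ ⟨z, rfl⟩
  set t : ℝ := z.im / τ.im
  set s : ℝ := (z - t * τ).re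
  have hz : z = s + t * τ := by
    apply Complex.ext
    · simp [s]
    · simp [t, hτ.ne']
  refine ⟨(Int.fract s, Int.fract t), ⟨⟨Int.fract_nonneg s, (Int.fract_lt_one s).le⟩,
    Int.fract_nonneg t, (Int.fract_lt_one t).le⟩, ?_⟩
  have e : ((Int.fract s : ℝ) : ℂ) + (Int.fract t : ℝ) * τ = z - ⌊s⌋ * 1 - ⌊t⌋ * τ := by
    rw [hz, Int.fract, Int.fract]
    push_cast
    ring
  simp only [e]
  rw [h₂.sub_int_mul_eq, h₁.sub_int_mul_eq]

/-- Two entire functions with the same multipliers along a lattice are proportional if the second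
vanishes only at lattice points and both have a simple zero at the origin. -/
lemma div_eq_div_of_quasiperiodic {τ : ℂ} (hτ : 0 < τ.im) {f g : ℂ → ℂ}
    (hf : Differentiable ℂ f) (hg : Differentiable ℂ g)
    (h₁ : ∀ z, ∃ a ≠ 0, f (z + 1) = a * f z ∧ g (z + 1) = a * g z)
    (h₂ : ∀ z, ∃ a ≠ 0, f (z + τ) = a * f z ∧ g (z + τ) = a * g z)
    (hz : ∀ z, g z = 0 → ∃ m n : ℤ, z = m + n * τ) (hf0 : f 0 = 0) (hg0 : g 0 = 0)
    {f' g' : ℂ} (hf' : HasDerivAt f f' 0) (hg' : HasDerivAt g g' 0) (hne : g' ≠ 0)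
    {z : ℂ} (hgz : g z ≠ 0) : f z / g z = f' / g' := by
  classical
  set F : ℂ → ℂ := fun z ↦ if g z = 0 then f' / g' else f z / g z with hF
  have periodic {ω : ℂ} (h : ∀ z, ∃ a ≠ 0, f (z + ω) = a * f z ∧ g (z + ω) = a * g z) :
      Function.Periodic F ω := by
    intro w
    obtain ⟨a, ha, hfa, hga⟩ := h w
    simp only [hF, hfa, hga, mul_eq_zero, ha, false_or]
    rw [mul_div_mul_left _ _ ha]
  have hp₁ : Function.Periodic F 1 := periodic h₁
  have hp₂ : Function.Periodic F τ := periodic h₂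
  have regular {w : ℂ} (hw : g w ≠ 0) : DifferentiableAt ℂ F w := by
    refine ((hf w).div (hg w) hw).congr_of_eventuallyEq ?_
    filter_upwards [(hg w).continuousAt.eventually_ne hw] with v hv
    simp [hF, hv]
  have hev : ∀ᶠ w in 𝓝[≠] (0 : ℂ), g w ≠ 0 := hg'.eventually_ne hne
  have hF0 : F 0 = f' / g' := by simp [hF, hg0]
  have hcont : ContinuousAt F 0 := by
    rw [continuousAt_iff_punctured_nhds, hF0]
    refine (hf'.tendsto_slope.div hg'.tendsto_slope hne).congr' ?_
    filter_upwards [hev, self_mem_nhdsWithin] with w hw hw0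
    have hw0' : w ≠ 0 := hw0
    simp only [hF, hw, if_false, Pi.div_apply, slope_def_field, hf0, hg0, sub_zero]
    field_simp
  have hdiff0 : DifferentiableAt ℂ F 0 :=
    (analyticAt_of_differentiable_on_punctured_nhds_of_continuousAt
      (hev.mono fun w hw ↦ regular hw) hcont).differentiableAt
  have hdiff : Differentiable ℂ F := by
    intro w
    by_cases hw : g w = 0
    · obtain ⟨m, n, hmn⟩ := hz w hw
      have hshift : F = fun v ↦ F (v - w) := by
        ext v
        rw [hmn, ← sub_sub, hp₂.sub_int_mul_eq, ← mul_one (m : ℂ), hp₁.sub_int_mul_eq]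
      rw [hshift]
      have : DifferentiableAt ℂ F (w - w) := by rwa [sub_self]
      exact this.comp w (f := fun v ↦ v - w) (differentiableAt_id.sub_const w)
    · exact regular hw
  have := hdiff.apply_eq_apply_of_bounded
    (isBounded_range_of_doubly_periodic hτ hdiff.continuous hp₁ hp₂) z 0
  simpa [hF, hgz, hg0] using this

lemma gammaNum_eq (τ z : ℂ) : gammaNum τ z = qPochhammer (expTwoPiI τ) (expTwoPiI (τ - z)) := by
  refine tprod_congr fun n ↦ ?_
  rw [← expTwoPiI_nat_mul, ← expTwoPiI_add, expTwoPiI]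
  ring_nf

lemma gammaDen_eq (τ z : ℂ) :
    gammaDen τ z = qPochhammer (expTwoPiI (-1 / τ)) (expTwoPiI (-z / τ)) := by
  refine tprod_congr fun n ↦ ?_
  rw [← expTwoPiI_nat_mul, ← expTwoPiI_add, expTwoPiI]
  ring_nf

lemma gammaNum_mul_reflection (τ z : ℂ) :
    gammaNum τ z * gammaNum τ (1 + τ - z) = thetaProd τ z := by
  rw [gammaNum_eq, gammaNum_eq, thetaProd, mul_comm, show τ - (1 + τ - z) = z - 1 by ring,
    expTwoPiI_sub z 1, expTwoPiI_one, div_one]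

lemma gammaDen_mul_reflection {τ : ℂ} (hτ : τ ≠ 0) (z : ℂ) :
    gammaDen τ z * gammaDen τ (1 + τ - z) = thetaProd (-1 / τ) (-z / τ) := by
  rw [gammaDen_eq, gammaDen_eq, thetaProd,
    show -(1 + τ - z) / τ = -1 / τ - -z / τ - 1 by field_simp; ring,
    expTwoPiI_sub _ 1, expTwoPiI_one, div_one]

lemma gammaFn_one (τ : ℂ) :
    gammaFn τ 1 = qPochhammer (expTwoPiI τ) (expTwoPiI τ) /
      qPochhammer (expTwoPiI (-1 / τ)) (expTwoPiI (-1 / τ)) := by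
  rw [gammaFn, gammaNum_eq, gammaDen_eq, expTwoPiI_sub, expTwoPiI_one, div_one]

lemma neg_one_div_im_pos {τ : ℂ} (hτ : 0 < τ.im) : 0 < (-1 / τ).im := by
  have h0 : τ ≠ 0 := fun h ↦ by simp [h] at hτ
  rw [neg_div, one_div, neg_im, inv_im, neg_div, neg_neg]
  exact div_pos hτ (normSq_pos.2 h0)

/-- The modular transformation of the theta product under `τ ↦ -1/τ`. -/
lemma thetaProd_div_thetaProd_neg_inv {τ : ℂ} (hτ : 0 < τ.im) {z : ℂ}
    (hz : thetaProd (-1 / τ) (-z / τ) ≠ 0) :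
    thetaProd τ z / thetaProd (-1 / τ) (-z / τ) =
      -τ * (gammaFn τ 1) ^ 2 * exp (Real.pi * I * z * (1 + τ - z) / τ) := by
  have h0 : τ ≠ 0 := fun h ↦ by simp [h] at hτ
  have hσ := neg_one_div_im_pos hτ
  have hQ := qPochhammer_self_ne_zero (norm_expTwoPiI_lt_one hσ)
  set E : ℂ → ℂ := fun z ↦ exp (Real.pi * I * z * (1 + τ - z) / τ) with hE
  have hEne (z : ℂ) : E z ≠ 0 := exp_ne_zero _
  have hEd : Differentiable ℂ E := by
    intro w
    simp only [hE]
    fun_prop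
  have hneg : Differentiable ℂ fun z : ℂ ↦ -z / τ := by fun_prop
  have hdd : Differentiable ℂ fun z ↦ thetaProd (-1 / τ) (-z / τ) :=
    (differentiable_thetaProd hσ).comp hneg
  have hE₁ (z : ℂ) : E (z + 1) = -expTwoPiI (-z / τ) * E z := by
    simp only [hE]
    rw [neg_eq_neg_one_mul (expTwoPiI _), ← exp_pi_mul_I, expTwoPiI, ← exp_add, ← exp_add]
    congr 1
    field_simp
    ring
  have hE₂ (z : ℂ) : E (z + τ) = -expTwoPiI (-z) * E z := by
    simp only [hE]
    rw [neg_eq_neg_one_mul (expTwoPiI _), ← exp_pi_mul_I, expTwoPiI, ← exp_add, ← exp_add]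
    congr 1
    field_simp
    ring
  have hd₁ (z : ℂ) : thetaProd (-1 / τ) (-(z + 1) / τ) =
      -expTwoPiI (z / τ) * thetaProd (-1 / τ) (-z / τ) := by
    rw [show -(z + 1) / τ = -z / τ + -1 / τ by ring, thetaProd_add_period hσ, neg_div, neg_neg]
  have hd₂ (z : ℂ) : thetaProd (-1 / τ) (-(z + τ) / τ) = thetaProd (-1 / τ) (-z / τ) := by
    rw [show -(z + τ) / τ = -z / τ - 1 by field_simp; ring, thetaProd_sub_one]
  have hee (z : ℂ) : expTwoPiI (z / τ) * expTwoPiI (-z / τ) = 1 := by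
    rw [← expTwoPiI_add, neg_div, add_neg_cancel, expTwoPiI_zero]
  have hderiv : HasDerivAt (fun z ↦ thetaProd (-1 / τ) (-z / τ) * E z)
      (2 * Real.pi * I / τ * qPochhammer (expTwoPiI (-1 / τ)) (expTwoPiI (-1 / τ)) ^ 2) 0 := by
    have hin : HasDerivAt (fun z : ℂ ↦ -z / τ) (-1 / τ) 0 := ((hasDerivAt_id 0).neg).div_const τ
    have h := hasDerivAt_thetaProd_zero hσ
    rw [show (0 : ℂ) = -0 / τ by simp] at h
    convert! (h.comp (0 : ℂ) hin).mul (hEd 0).hasDerivAt using 1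
    simp [hE, thetaProd_zero hσ]
    ring
  have key := div_eq_div_of_quasiperiodic hτ (differentiable_thetaProd hτ) (hdd.mul hEd)
    (fun w ↦ ⟨1, one_ne_zero, by rw [one_mul, thetaProd_add_one], by
      simp only [Pi.mul_apply]
      rw [hd₁, hE₁]
      linear_combination thetaProd (-1 / τ) (-w / τ) * E w * hee w⟩)
    (fun w ↦ ⟨-expTwoPiI (-w), neg_ne_zero.2 (expTwoPiI_ne_zero _),
      thetaProd_add_period hτ w, by
      simp only [Pi.mul_apply]
      rw [hd₂, hE₂]
      ring⟩)
    (fun w hw ↦ by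
      obtain ⟨m, n, hmn⟩ := exists_int_of_thetaProd_eq_zero hσ
        ((mul_eq_zero.1 hw).resolve_right (hEne w))
      refine ⟨n, -m, ?_⟩
      field_simp at hmn
      push_cast
      linear_combination -hmn)
    (thetaProd_zero hτ) (by simp [thetaProd_zero hσ]) (hasDerivAt_thetaProd_zero hτ) hderiv
    (by simp [h0, hQ, Real.pi_ne_zero]) (z := z) (mul_ne_zero hz (hEne z))
  simp only [Pi.mul_apply] at key
  have hEz := hEne z
  rw [← div_div, div_eq_iff hEz] at key
  rw [key, gammaFn_one]
  congr 1
  have hpi' : (Real.pi : ℂ) ≠ 0 := by simp [Real.pi_ne_zero]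
  field_simp

/-- Reflection formula: `γ(z)γ(1+τ−z) = −τ γ(1)² e^{iπ z(1+τ−z)/τ}`. -/
theorem stmt10 (τ : ℂ) (hτ : 0 < τ.im) (z : ℂ)
    (hd : gammaDen τ z ≠ 0) (hd' : gammaDen τ (1 + τ - z) ≠ 0) :
    gammaFn τ z * gammaFn τ (1 + τ - z) =
      -τ * (gammaFn τ 1) ^ 2 * Complex.exp (Real.pi * Complex.I * z * (1 + τ - z) / τ) := by
  have h0 : τ ≠ 0 := fun h ↦ by simp [h] at hτ
  have hne := mul_ne_zero hd hd'
  rw [gammaDen_mul_reflection h0] at hne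
  rw [← thetaProd_div_thetaProd_neg_inv hτ hne, ← gammaNum_mul_reflection,
    ← gammaDen_mul_reflection h0, gammaFn, gammaFn, div_mul_div_comm]
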